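/- arXiv:math/9602212 — 2 statements merged into one kernel-verified Lean document; each statement's English description precedes it below -/
import Mathlib

section
/- Let w ∈ W be in reduced form, satisfy Hypothesis (E), and assume w(n) = n'. Then w·W_M = w₀·W_M; moreover, if W is the full group of permutations commuting with ι (the case G ≠ SO(2r)), then w = w₀. -/
/-!  Common framework: Weyl groups of classical groups, modeled as permutations of ℕ
supported on `{1,…,r₀}`, with the convention `i' = r₀ + 1 - i`. -/

/-- `IsWfull r₀ w`: `w` fixes every point outside `{1,…,r₀}` and commutes with the
involution `ι : i ↦ r₀ + 1 - i` on `{1,…,r₀}`.  This is the full group of permutations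
of `{1,…,r₀}` commuting with `ι` (the Weyl group of `SO(2r+1)`, `U(2r+1)` or `U(2r)`). -/
def IsWfull (r₀ : ℕ) (w : Equiv.Perm ℕ) : Prop :=
  (∀ i : ℕ, ¬(1 ≤ i ∧ i ≤ r₀) → w i = i) ∧
  (∀ i : ℕ, 1 ≤ i → i ≤ r₀ → w (r₀ + 1 - i) = r₀ + 1 - w i)

/-- The parity condition singling out the Weyl group of `SO(2r)`:
the number of indices `1 ≤ i ≤ r` with `w i > r` is even. -/
def EvenCond (r : ℕ) (w : Equiv.Perm ℕ) : Prop :=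
  Even (((Finset.Icc 1 r).filter (fun i => r < w i)).card)

/-- Membership in `W`; the proposition `so2r` indicates whether we are in the `SO(2r)`
case (where the parity condition is imposed on top of `IsWfull`). -/
def MemW (r r₀ : ℕ) (so2r : Prop) (w : Equiv.Perm ℕ) : Prop :=
  IsWfull r₀ w ∧ (so2r → EvenCond r w)

/-- Membership in `W_M`: an element of `W` with `w({1,…,n}) = {1,…,n}` and
`w({n+1,…,r₀−n}) = {n+1,…,r₀−n}`. -/
def MemWM (r r₀ n : ℕ) (so2r : Prop) (m : Equiv.Perm ℕ) : Prop :=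
  MemW r r₀ so2r m ∧
  (Finset.Icc 1 n).image (fun i => m i) = Finset.Icc 1 n ∧
  (Finset.Icc (n + 1) (r₀ - n)).image (fun i => m i) = Finset.Icc (n + 1) (r₀ - n)

/-- The left coset `w·{m | P m}`. -/
def coset (P : Equiv.Perm ℕ → Prop) (w : Equiv.Perm ℕ) : Set (Equiv.Perm ℕ) :=
  {x | ∃ m, P m ∧ x = w * m}

/-- `w` is in standard form: a product of pairwise disjoint transpositions
`∏ᵢ (aᵢ aᵢ') · ∏ᵢ (bᵢ cᵢ)(cᵢ' bᵢ')` with `aᵢ, bᵢ ∈ {1,…,n}` and `cᵢ ∈ {n+1,…,r₀−n}`.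
This is encoded pointwise: `w` belongs to the full group `W`, is an involution, every
moved point `i ∈ {1,…,n}` has `w i = i'` or `w i ∈ {n+1,…,r₀−n}`, and every moved
point `i ∈ {n+1,…,r₀−n}` has `w i ∈ {1,…,n}` or `w i ∈ {n',…,r₀}`. -/
def IsStandardForm (r₀ n : ℕ) (w : Equiv.Perm ℕ) : Prop :=
  IsWfull r₀ w ∧ w * w = 1 ∧
  (∀ i, 1 ≤ i → i ≤ n → w i ≠ i →
    (w i = r₀ + 1 - i ∨ (n + 1 ≤ w i ∧ w i ≤ r₀ - n))) ∧
  (∀ i, n + 1 ≤ i → i ≤ r₀ - n → w i ≠ i →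
    (w i ≤ n ∨ r₀ + 1 - n ≤ w i))

/-- The 4-cycle `(a b c d)` sending `a ↦ b ↦ c ↦ d ↦ a`. -/
def cycle4 (a b c d : ℕ) : Equiv.Perm ℕ :=
  Equiv.swap a b * Equiv.swap b c * Equiv.swap c d

/-- `w` is in reduced form: `w = w₁ w₂` with `w₁` in standard form, `w₂` disjoint from
`w₁`, and `w₂` either the identity, or (only in the `SO(2r)` case) a transposition
`(d₀ d₀')` with `n+1 ≤ d₀ ≤ r`, or a 4-cycle `(i₀ j₀' i₀' j₀)` with `1 ≤ i₀ ≤ n < j₀ ≤ r`. -/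
def IsReducedForm (r r₀ n : ℕ) (so2r : Prop) (w : Equiv.Perm ℕ) : Prop :=
  ∃ w₁ w₂ : Equiv.Perm ℕ,
    IsStandardForm r₀ n w₁ ∧ w = w₁ * w₂ ∧ Equiv.Perm.Disjoint w₁ w₂ ∧
    (w₂ = 1 ∨
      (so2r ∧
        ((∃ d₀, n + 1 ≤ d₀ ∧ d₀ ≤ r ∧ w₂ = Equiv.swap d₀ (r₀ + 1 - d₀)) ∨
         (∃ i₀ j₀, 1 ≤ i₀ ∧ i₀ ≤ n ∧ n < j₀ ∧ j₀ ≤ r ∧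
            w₂ = cycle4 i₀ (r₀ + 1 - j₀) (r₀ + 1 - i₀) j₀))))

/-- The vector `e_i : {1,…,r₀} → ℤ` with `e_i(i) = 1`, `e_i(i') = −1`, `0` elsewhere. -/
def evec (r₀ i : ℕ) : ℕ → ℤ :=
  fun k => if k = i then 1 else if k = r₀ + 1 - i then -1 else 0

/-- The simple root `α_i = e_i − e_{i+1}`. -/
def rootAlpha (r₀ i : ℕ) : ℕ → ℤ := evec r₀ i - evec r₀ (i + 1)

/-- The root `β = e_ℓ + e_{ℓ+1}`. -/
def rootBeta (r₀ l : ℕ) : ℕ → ℤ := evec r₀ l + evec r₀ (l + 1)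

/-- The action of `w` on root vectors: `(w·v)(k) = v(w⁻¹ k)`. -/
def pact (w : Equiv.Perm ℕ) (v : ℕ → ℤ) : ℕ → ℤ := fun k => v (w⁻¹ k)

/-- The set `X = {α_1,…,α_ℓ, β}`. -/
def Xset (r₀ l : ℕ) : Set (ℕ → ℤ) :=
  {v | (∃ i, 1 ≤ i ∧ i ≤ l ∧ v = rootAlpha r₀ i) ∨ v = rootBeta r₀ l}

/-- The set of short and long roots `{e_i, 2e_i : 1 ≤ i ≤ n}` from which `S₀` is drawn. -/
def ShortLong (r₀ n : ℕ) : Set (ℕ → ℤ) :=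
  {v | ∃ i, 1 ≤ i ∧ i ≤ n ∧ (v = evec r₀ i ∨ v = evec r₀ i + evec r₀ i)}

/-- `Σ_P^+ = {e_i ± e_j : 1 ≤ i ≤ n < j ≤ r} ∪ {e_i + e_j : 1 ≤ i < j ≤ n} ∪ S₀`. -/
def SigmaP (r r₀ n : ℕ) (S₀ : Set (ℕ → ℤ)) : Set (ℕ → ℤ) :=
  {v | ∃ i j, 1 ≤ i ∧ i ≤ n ∧ n < j ∧ j ≤ r ∧
        (v = evec r₀ i - evec r₀ j ∨ v = evec r₀ i + evec r₀ j)} ∪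
  {v | ∃ i j, 1 ≤ i ∧ i < j ∧ j ≤ n ∧ v = evec r₀ i + evec r₀ j} ∪ S₀

/-- Hypothesis (E): `w·α ∉ X` for every `α ∈ Σ_P^+`. -/
def HypE (r r₀ n l : ℕ) (S₀ : Set (ℕ → ℤ)) (w : Equiv.Perm ℕ) : Prop :=
  ∀ α ∈ SigmaP r r₀ n S₀, pact w α ∉ Xset r₀ l

/-- Hypothesis (L): `α_ℓ = w·α` for some `α ∈ Σ_P^+`; no other element of `X` is of the
form `w·α` with `α ∈ Σ_P^+`; and `w⁻¹·α_ℓ` is not of the form `e_i + e_j` with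
`1 ≤ i, j ≤ n`. -/
def HypL (r r₀ n l : ℕ) (S₀ : Set (ℕ → ℤ)) (w : Equiv.Perm ℕ) : Prop :=
  (∃ α ∈ SigmaP r r₀ n S₀, pact w α = rootAlpha r₀ l) ∧
  (∀ α ∈ SigmaP r r₀ n S₀, pact w α ∈ Xset r₀ l → pact w α = rootAlpha r₀ l) ∧
  ¬ ∃ i j, 1 ≤ i ∧ i ≤ n ∧ 1 ≤ j ∧ j ≤ n ∧
      pact w⁻¹ (rootAlpha r₀ l) = evec r₀ i + evec r₀ j

/-- The permutation `(1 r₀)(2 r₀−1)⋯(n n')`. -/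
def w0base (r₀ n : ℕ) : Equiv.Perm ℕ :=
  (((List.range n).map (fun i => Equiv.swap (i + 1) (r₀ - i))).prod)
namespace IsWfull

variable {r r₀ : ℕ} {w m : Equiv.Perm ℕ}

theorem apply_mem (hw : IsWfull r₀ w) {i : ℕ} (h1 : 1 ≤ i) (h2 : i ≤ r₀) :
    1 ≤ w i ∧ w i ≤ r₀ := by
  by_contra h
  have h' : w i = i := w.injective (hw.1 _ h)
  exact h (h'.symm ▸ ⟨h1, h2⟩)

theorem mul (hw : IsWfull r₀ w) (hm : IsWfull r₀ m) : IsWfull r₀ (w * m) := by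
  refine ⟨fun i hi => ?_, fun i h1 h2 => ?_⟩
  · rw [Equiv.Perm.mul_apply, hm.1 i hi, hw.1 i hi]
  · have h := hm.apply_mem h1 h2
    rw [Equiv.Perm.mul_apply, Equiv.Perm.mul_apply, hm.2 i h1 h2, hw.2 _ h.1 h.2]

theorem inv (hw : IsWfull r₀ w) : IsWfull r₀ w⁻¹ := by
  have fixed : ∀ i, ¬(1 ≤ i ∧ i ≤ r₀) → w⁻¹ i = i := fun i hi =>
    Equiv.Perm.inv_eq_iff_eq.2 (hw.1 i hi).symm
  refine ⟨fixed, fun i h1 h2 => ?_⟩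
  have hmem : 1 ≤ w⁻¹ i ∧ w⁻¹ i ≤ r₀ := by
    by_contra h
    have h' : w⁻¹ i = i := w⁻¹.injective (fixed _ h)
    exact h (h'.symm ▸ ⟨h1, h2⟩)
  rw [Equiv.Perm.inv_eq_iff_eq, hw.2 _ hmem.1 hmem.2, Equiv.Perm.coe_inv, Equiv.apply_symm_apply]

/-- The action of `w` sends `e_i` to `e_{w i}`. -/
theorem pact_evec (hw : IsWfull r₀ w) {i : ℕ} (h1 : 1 ≤ i) (h2 : i ≤ r₀) :
    pact w (evec r₀ i) = evec r₀ (w i) := by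
  funext k
  simp only [pact, evec, Equiv.Perm.inv_eq_iff_eq, hw.2 i h1 h2]

end IsWfull

theorem evec_reflect {r₀ i : ℕ} (h2 : i ≤ r₀) (hi : r₀ + 1 - i ≠ i) :
    evec r₀ (r₀ + 1 - i) = -evec r₀ i := by
  funext k
  simp only [evec, Pi.neg_apply]
  grind

/-- The sign character of the hyperoctahedral group counting sign changes. -/
def flipSign (r : ℕ) (w : Equiv.Perm ℕ) : ℤ :=
  ∏ i ∈ Finset.Icc 1 r, if r < w i then -1 else 1

theorem evenCond_iff {r : ℕ} {w : Equiv.Perm ℕ} : EvenCond r w ↔ flipSign r w = 1 := by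
  unfold EvenCond flipSign
  rw [Finset.prod_ite, Finset.prod_const, Finset.prod_const_one, mul_one,
    neg_one_pow_eq_one_iff_even (by norm_num)]

theorem flipSign_mul {r : ℕ} {w m : Equiv.Perm ℕ} (hw : IsWfull (2 * r) w)
    (hm : IsWfull (2 * r) m) : flipSign r (w * m) = flipSign r w * flipSign r m := by
  let f : ℕ → ℕ := fun i => if r < m i then 2 * r + 1 - m i else m i
  have hf : flipSign r w = ∏ i ∈ Finset.Icc 1 r, if r < w (f i) then -1 else 1 := by
    have maps : ∀ i ∈ Finset.Icc 1 r, f i ∈ Finset.Icc 1 r := by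
      intro i hi
      rw [Finset.mem_Icc] at hi ⊢
      have := hm.apply_mem hi.1 (by omega)
      grind
    have inj : Set.InjOn f (Finset.Icc 1 r) := by
      intro i hi j hj hij
      rw [Finset.mem_coe, Finset.mem_Icc] at hi hj
      have hi' := hm.apply_mem hi.1 (by omega)
      have hj' := hm.apply_mem hj.1 (by omega)
      have hi2 := hm.2 i hi.1 (by omega)
      have hcase : m i = m j ∨ m (2 * r + 1 - i) = m j := by grind
      rcases hcase with h | h
      · exact m.injective h
      · have := m.injective h
        omega
    have himg : (Finset.Icc 1 r).image f = Finset.Icc 1 r :=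
      Finset.eq_of_subset_of_card_le (Finset.image_subset_iff.2 maps)
        (Finset.card_image_of_injOn inj).ge
    unfold flipSign
    conv_lhs => rw [← himg]
    exact Finset.prod_image inj
  rw [hf]
  unfold flipSign
  rw [← Finset.prod_mul_distrib]
  refine Finset.prod_congr rfl fun i hi => ?_
  rw [Finset.mem_Icc] at hi
  have h1 := hm.apply_mem hi.1 (by omega)
  have h2 := hw.apply_mem h1.1 h1.2
  have h3 := hw.2 _ h1.1 h1.2
  rw [Equiv.Perm.mul_apply]
  by_cases h : r < m i
  · have hfi : f i = 2 * r + 1 - m i := if_pos h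
    rw [if_pos h, hfi, h3]
    by_cases h' : r < w (m i)
    · rw [if_pos h', if_neg (by omega), one_mul]
    · rw [if_neg h', if_pos (by omega), neg_mul_neg, one_mul]
  · have hfi : f i = m i := if_neg h
    rw [if_neg h, hfi, mul_one]

section Membership

variable {r r₀ n : ℕ} {so2r : Prop} {w m : Equiv.Perm ℕ}

theorem MemW.mul (hso : so2r → r₀ = 2 * r) (hw : MemW r r₀ so2r w) (hm : MemW r r₀ so2r m) :
    MemW r r₀ so2r (w * m) := by
  refine ⟨hw.1.mul hm.1, fun h => ?_⟩
  obtain rfl := hso h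
  rw [evenCond_iff, flipSign_mul hw.1 hm.1, evenCond_iff.1 (hw.2 h), evenCond_iff.1 (hm.2 h),
    one_mul]

theorem MemW.inv (hso : so2r → r₀ = 2 * r) (hw : MemW r r₀ so2r w) : MemW r r₀ so2r w⁻¹ := by
  refine ⟨hw.1.inv, fun h => ?_⟩
  obtain rfl := hso h
  have one : flipSign r 1 = 1 := Finset.prod_eq_one fun i hi => by
    rw [Finset.mem_Icc] at hi
    exact if_neg (by rw [Equiv.Perm.one_apply]; omega)
  have key := flipSign_mul hw.1 hw.1.inv
  rw [mul_inv_cancel, one, evenCond_iff.1 (hw.2 h), one_mul] at key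
  exact evenCond_iff.2 key.symm

theorem image_perm_eq_iff {S : Finset ℕ} :
    S.image (fun i => m i) = S ↔ ∀ i ∈ S, m i ∈ S :=
  ⟨fun h _ hi => h ▸ Finset.mem_image_of_mem _ hi, fun h =>
    Finset.eq_of_subset_of_card_le (Finset.image_subset_iff.2 h)
      (Finset.card_image_of_injective _ m.injective).ge⟩

theorem image_perm_mul {S : Finset ℕ} (hw : S.image (fun i => w i) = S)
    (hm : S.image (fun i => m i) = S) : S.image (fun i => (w * m) i) = S := by
  rw [image_perm_eq_iff] at *
  exact fun i hi => hw _ (hm i hi)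

theorem image_perm_inv {S : Finset ℕ} (hw : S.image (fun i => w i) = S) :
    S.image (fun i => w⁻¹ i) = S := by
  refine image_perm_eq_iff.2 fun i hi => ?_
  rw [← hw, Finset.mem_image] at hi
  obtain ⟨j, hj, rfl⟩ := hi
  simpa using hj

theorem MemWM.mul (hso : so2r → r₀ = 2 * r) (hw : MemWM r r₀ n so2r w)
    (hm : MemWM r r₀ n so2r m) : MemWM r r₀ n so2r (w * m) :=
  ⟨hw.1.mul hso hm.1, image_perm_mul hw.2.1 hm.2.1, image_perm_mul hw.2.2 hm.2.2⟩

theorem MemWM.inv (hso : so2r → r₀ = 2 * r) (hw : MemWM r r₀ n so2r w) :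
    MemWM r r₀ n so2r w⁻¹ :=
  ⟨hw.1.inv hso, image_perm_inv hw.2.1, image_perm_inv hw.2.2⟩

theorem coset_eq_of_inv_mul_mem (hso : so2r → r₀ = 2 * r) (h : MemWM r r₀ n so2r (m⁻¹ * w)) :
    coset (MemWM r r₀ n so2r) w = coset (MemWM r r₀ n so2r) m := by
  ext x
  constructor
  · rintro ⟨y, hy, rfl⟩
    exact ⟨m⁻¹ * w * y, h.mul hso hy, by group⟩
  · rintro ⟨y, hy, rfl⟩
    exact ⟨(m⁻¹ * w)⁻¹ * y, (h.inv hso).mul hso hy, by group⟩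

end Membership

theorem w0base_apply {r₀ n : ℕ} (h : 2 * n ≤ r₀) (k : ℕ) :
    w0base r₀ n k =
      if (1 ≤ k ∧ k ≤ n) ∨ (r₀ + 1 - n ≤ k ∧ k ≤ r₀) then r₀ + 1 - k else k := by
  induction n generalizing k with
  | zero =>
    rw [if_neg (by omega)]
    simp [w0base]
  | succ n ih =>
    have step : w0base r₀ (n + 1) = w0base r₀ n * Equiv.swap (n + 1) (r₀ - n) := by
      simp [w0base, List.range_succ]
    rw [step, Equiv.Perm.mul_apply, ih (by omega), Equiv.swap_apply_def]
    grind

theorem isWfull_w0base {r₀ n : ℕ} (h : 2 * n ≤ r₀) : IsWfull r₀ (w0base r₀ n) := by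
  refine ⟨fun i hi => ?_, fun i h1 h2 => ?_⟩
  · rw [w0base_apply h, if_neg (by omega)]
  · rw [w0base_apply h, w0base_apply h]
    grind

theorem isWfull_swap_middle (r : ℕ) (hr : 1 ≤ r) :
    IsWfull (2 * r) (Equiv.swap r (r + 1)) := by
  refine ⟨fun i hi => ?_, fun i h1 h2 => ?_⟩
  · exact Equiv.swap_apply_of_ne_of_ne (by omega) (by omega)
  · simp only [Equiv.swap_apply_def]
    grind

theorem evenCond_w0base {r n : ℕ} (hnr : n < r) (hn : Even n) :
    EvenCond r (w0base (2 * r) n) := by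
  have : (Finset.Icc 1 r).filter (fun i => r < w0base (2 * r) n i) = Finset.Icc 1 n := by
    ext i
    rw [Finset.mem_filter, Finset.mem_Icc, Finset.mem_Icc, w0base_apply (by omega)]
    grind
  rw [EvenCond, this]
  simpa using hn

theorem evenCond_w0base_mul_swap {r n : ℕ} (hnr : n < r) (hn : Odd n) :
    EvenCond r (w0base (2 * r) n * Equiv.swap r (r + 1)) := by
  have : (Finset.Icc 1 r).filter
      (fun i => r < (w0base (2 * r) n * Equiv.swap r (r + 1)) i) =
      insert r (Finset.Icc 1 n) := by
    ext i
    rw [Finset.mem_filter, Finset.mem_Icc, Finset.mem_insert, Finset.mem_Icc,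
      Equiv.Perm.mul_apply, w0base_apply (by omega), Equiv.swap_apply_def]
    grind
  rw [EvenCond, this, Finset.card_insert_of_notMem (by simpa using fun _ => hnr)]
  simpa using hn.add_one

/-- A reduced-form element sending `i ≤ n` into `{n',…,r₀}` sends it to `i'`. -/
theorem IsReducedForm.apply_eq_reflect {r r₀ n i : ℕ} {so2r : Prop} {w : Equiv.Perm ℕ}
    (hred : IsReducedForm r r₀ n so2r w) (hnr : n < r) (hr₀ : 2 * r ≤ r₀) (h1 : 1 ≤ i)
    (hin : i ≤ n) (hwi : r₀ + 1 - n ≤ w i) : w i = r₀ + 1 - i := by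
  obtain ⟨w₁, w₂, hst, rfl, hdisj, hw₂⟩ := hred
  rw [Equiv.Perm.mul_apply] at hwi ⊢
  by_cases hfix : w₂ i = i
  · rw [hfix] at hwi ⊢
    rcases hst.2.2.1 i h1 hin (by omega) with h | h <;> omega
  · exfalso
    have hw₁ : w₁ (w₂ i) = w₂ i :=
      (hdisj (w₂ i)).resolve_right fun h => hfix (w₂.injective h)
    rw [hw₁] at hwi
    rcases hw₂ with rfl | ⟨-, ⟨d, hd1, hd2, rfl⟩ | ⟨a, b, ha1, ha2, hb1, hb2, rfl⟩⟩
    · exact hfix rfl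
    · exact hfix (Equiv.swap_apply_of_ne_of_ne (by omega) (by omega))
    · simp only [cycle4, Equiv.Perm.mul_apply, Equiv.swap_apply_def] at hwi hfix
      grind

/-- Outside the `SO(2r)` case, reduced forms are standard forms. -/
theorem IsReducedForm.isStandardForm {r r₀ n : ℕ} {so2r : Prop} {w : Equiv.Perm ℕ}
    (hred : IsReducedForm r r₀ n so2r w) (hso : ¬so2r) : IsStandardForm r₀ n w := by
  obtain ⟨w₁, w₂, hst, rfl, -, rfl | ⟨h, -⟩⟩ := hred
  · rwa [mul_one]
  · exact absurd h hso

/-- Under Hypothesis (E), `w (i+1) = (i+1)'` with `i < n` forces `w` to send an index in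
`{n',…,r₀}` to `i`. -/
theorem HypE.le_inv_apply {r r₀ n l i : ℕ} {S₀ : Set (ℕ → ℤ)} {w : Equiv.Perm ℕ}
    (hE : HypE r r₀ n l S₀ w) (hw : IsWfull r₀ w) (hnl : n ≤ l) (hnr : n < r)
    (hr₀ : r₀ = 2 * r ∨ r₀ = 2 * r + 1) (h1 : 1 ≤ i) (hin : i < n)
    (hwi : w (i + 1) = r₀ + 1 - (i + 1)) : r₀ + 1 - n ≤ w⁻¹ i := by
  obtain ⟨k, hk⟩ : ∃ k, w⁻¹ i = k := ⟨_, rfl⟩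
  have hwk : w k = i := by rw [← hk, Equiv.Perm.coe_inv, Equiv.apply_symm_apply]
  have hkmem := hw.inv.apply_mem h1 (by omega)
  rw [hk] at hkmem ⊢
  by_contra! hlt
  have hroot : pact w (evec r₀ k + evec r₀ (i + 1)) = rootAlpha r₀ i := by
    change pact w (evec r₀ k) + pact w (evec r₀ (i + 1)) = _
    rw [hw.pact_evec hkmem.1 hkmem.2, hw.pact_evec (by omega) (by omega), hwk, hwi,
      evec_reflect (by omega) (by omega), rootAlpha, sub_eq_add_neg]
  refine hE (evec r₀ k + evec r₀ (i + 1)) (Or.inl ?_) (Or.inl ⟨i, h1, by omega, hroot⟩)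
  have hne : k ≠ i + 1 := by rintro rfl; omega
  have hmid : r₀ + 1 - k ≠ k := by
    intro h
    have := hw.2 k hkmem.1 hkmem.2
    rw [h, hwk] at this
    omega
  by_cases hkn : k ≤ n
  · right
    rcases lt_or_gt_of_ne hne with h | h
    · exact ⟨k, i + 1, hkmem.1, h, hin, rfl⟩
    · exact ⟨i + 1, k, by omega, h, hkn, add_comm _ _⟩
  · left
    by_cases hkr : k ≤ r
    · exact ⟨i + 1, k, by omega, by omega, by omega, hkr, Or.inr (add_comm _ _)⟩
    · refine ⟨i + 1, r₀ + 1 - k, by omega, by omega, by omega, by omega, Or.inl ?_⟩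
      rw [evec_reflect hkmem.2 hmid, sub_neg_eq_add, add_comm]

/-- if `w ∈ W` is in reduced form, satisfies Hypothesis (E), and
`w n = n'`, then `w·W_M = w₀·W_M`, where `w₀ = (1 r₀)(2 r₀−1)⋯(n n')`,
multiplied by `(r r+1)` in the `SO(2r)` case with `n` odd; moreover in the
full-group case `w = w₀`. -/
theorem stmt9 (r n ℓ r₀ : ℕ) (so2r : Prop)
    (hn : 1 ≤ n) (hnl : n ≤ ℓ) (hlr : ℓ + 1 ≤ r)
    (hr₀ : r₀ = 2 * r ∨ r₀ = 2 * r + 1) (hso : so2r → r₀ = 2 * r)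
    (S₀ : Set (ℕ → ℤ)) (hS₀ : S₀ ⊆ ShortLong r₀ n)
    (w : Equiv.Perm ℕ) (hw : MemW r r₀ so2r w)
    (hred : IsReducedForm r r₀ n so2r w)
    (hE : HypE r r₀ n ℓ S₀ w)
    (hwn : w n = r₀ + 1 - n) :
    ∃ w₀ : Equiv.Perm ℕ,
      ((so2r ∧ Odd n) → w₀ = w0base r₀ n * Equiv.swap r (r + 1)) ∧
      (¬(so2r ∧ Odd n) → w₀ = w0base r₀ n) ∧
      coset (MemWM r r₀ n so2r) w = coset (MemWM r r₀ n so2r) w₀ ∧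
      (¬so2r → w = w₀) := by
  have hnr : n < r := by omega
  have hwW := hw.1
  have reflect : ∀ i, i ≤ n → 1 ≤ i → w i = r₀ + 1 - i := by
    intro i hin
    induction hin using Nat.decreasingInduction with
    | self => exact fun _ => hwn
    | of_succ i hin ih =>
      intro h1
      have hge := hE.le_inv_apply hwW hnl hnr hr₀ h1 hin (ih (by omega))
      have hle := (hwW.inv.apply_mem h1 (by omega)).2
      have happ : w (w⁻¹ i) = i := w.apply_symm_apply i
      have hflip := hwW.2 _ (by omega) hle
      rw [happ] at hflip
      have hrefl := hred.apply_eq_reflect hnr (by omega) (i := r₀ + 1 - w⁻¹ i) (by omega) (by omega)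
        (by omega)
      rw [show w⁻¹ i = r₀ + 1 - i by omega, show r₀ + 1 - (r₀ + 1 - i) = i by omega] at hflip
      exact hflip
  have reflect' : ∀ i, r₀ + 1 - n ≤ i → i ≤ r₀ → w i = r₀ + 1 - i := by
    intro i hi hi'
    have h := hwW.2 (r₀ + 1 - i) (by omega) (by omega)
    rw [reflect (r₀ + 1 - i) (by omega) (by omega)] at h
    rw [show r₀ + 1 - (r₀ + 1 - i) = i by omega] at h
    exact h
  have middle : ∀ i, n + 1 ≤ i → i ≤ r₀ - n → n + 1 ≤ w i ∧ w i ≤ r₀ - n := by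
    intro i hi hi'
    have hm := hwW.apply_mem (i := i) (by omega) (by omega)
    by_contra hout
    have hfix : w (r₀ + 1 - w i) = w i := by
      by_cases h : w i ≤ n
      · rw [reflect' _ (by omega) (by omega)]; omega
      · rw [reflect _ (by omega) (by omega)]; omega
    have := w.injective hfix
    omega
  have coset_eq : ∀ w₀, MemW r r₀ so2r w₀ →
      (∀ i, 1 ≤ i → i ≤ n → w₀ i = r₀ + 1 - i) →
      (∀ i, n + 1 ≤ i → i ≤ r₀ - n → n + 1 ≤ w₀ i ∧ w₀ i ≤ r₀ - n) →
      coset (MemWM r r₀ n so2r) w = coset (MemWM r r₀ n so2r) w₀ := by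
    intro w₀ h₀ hrefl hmid
    refine coset_eq_of_inv_mul_mem hso ⟨(h₀.inv hso).mul hso hw, ?_, ?_⟩
    · refine image_perm_eq_iff.2 fun i hi => ?_
      rw [Finset.mem_Icc] at hi
      rw [Equiv.Perm.mul_apply, reflect i hi.2 hi.1, ← hrefl i hi.1 hi.2,
        Equiv.Perm.coe_inv, Equiv.symm_apply_apply]
      exact Finset.mem_Icc.2 hi
    · refine image_perm_mul (image_perm_inv ?_) ?_ <;>
        refine image_perm_eq_iff.2 fun i hi => ?_ <;>
        rw [Finset.mem_Icc] at hi ⊢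
      · exact hmid i hi.1 hi.2
      · exact middle i hi.1 hi.2
  have h2n : 2 * n ≤ r₀ := by omega
  by_cases hodd : so2r ∧ Odd n
  · refine ⟨w0base r₀ n * Equiv.swap r (r + 1), fun _ => rfl, fun h => absurd hodd h, ?_,
      fun h => absurd hodd.1 h⟩
    obtain rfl := hso hodd.1
    refine coset_eq _ ⟨(isWfull_w0base h2n).mul (isWfull_swap_middle r (by omega)),
      fun _ => evenCond_w0base_mul_swap hnr hodd.2⟩ ?_ ?_
    · intro i h1 hin
      rw [Equiv.Perm.mul_apply, Equiv.swap_apply_of_ne_of_ne (by omega) (by omega),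
        w0base_apply h2n, if_pos (by omega)]
    · intro i hi hi'
      have hs : n + 1 ≤ Equiv.swap r (r + 1) i ∧ Equiv.swap r (r + 1) i ≤ 2 * r - n := by
        rw [Equiv.swap_apply_def]
        split_ifs <;> omega
      rwa [Equiv.Perm.mul_apply, w0base_apply h2n, if_neg (by omega)]
  · refine ⟨w0base r₀ n, fun h => absurd h hodd, fun _ => rfl, ?_, fun hns => ?_⟩
    · refine coset_eq _ ⟨isWfull_w0base h2n, fun h => ?_⟩ ?_ ?_
      · obtain rfl := hso h
        exact evenCond_w0base hnr (Nat.not_odd_iff_even.1 fun h' => hodd ⟨h, h'⟩)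
      · intro i h1 hin
        rw [w0base_apply h2n, if_pos (by omega)]
      · intro i hi hi'
        rw [w0base_apply h2n, if_neg (by omega)]
        exact ⟨hi, hi'⟩
    · ext i
      rw [w0base_apply h2n]
      split_ifs with h
      · exact h.elim (fun h => reflect i h.2 h.1) fun h => reflect' i h.1 h.2
      · by_cases hi : 1 ≤ i ∧ i ≤ r₀
        · have hm := middle i (by omega) (by omega)
          by_contra hne
          have := (hred.isStandardForm hns).2.2.2 i (by omega) (by omega) hne
          omega
        · exact hwW.1 i hi
end

section
/- Let w ∈ W be in reduced form and satisfy Hypothesis (L). Then for all k with n+1 ≤ k ≤ ℓ−1, one has w⁻¹(k) > n, i.e. w⁻¹(k) ∉ {1,…,n}. -/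
theorem IsWfull.inv_s12 {r₀ : ℕ} {w : Equiv.Perm ℕ} (h : IsWfull r₀ w) : IsWfull r₀ w⁻¹ := by
  have hmem : ∀ i, 1 ≤ i → i ≤ r₀ → 1 ≤ w⁻¹ i ∧ w⁻¹ i ≤ r₀ := by
    intro i h1 h2
    by_contra hc
    have h3 := h.1 _ hc
    have h4 : w (w⁻¹ i) = i := w.apply_symm_apply i
    omega
  refine ⟨fun i hi => ?_, fun i h1 h2 => ?_⟩
  · rw [Equiv.Perm.inv_eq_iff_eq, h.1 i hi]
  · obtain ⟨h3, h4⟩ := hmem i h1 h2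
    rw [Equiv.Perm.inv_eq_iff_eq, h.2 _ h3 h4, show w (w⁻¹ i) = i from w.apply_symm_apply i]

theorem IsWfull.mem_range {r₀ : ℕ} {w : Equiv.Perm ℕ} (h : IsWfull r₀ w) {i : ℕ}
    (h1 : 1 ≤ i) (h2 : i ≤ r₀) : 1 ≤ w i ∧ w i ≤ r₀ := by
  by_contra hc
  have h3 := w.injective (h.1 _ hc)
  omega

/-- `w · e_i = e_{w i}`. -/
theorem pact_evec {r₀ : ℕ} {w : Equiv.Perm ℕ} (h : IsWfull r₀ w) {i : ℕ}
    (h1 : 1 ≤ i) (h2 : i ≤ r₀) : pact w (evec r₀ i) = evec r₀ (w i) := by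
  funext k
  simp only [pact, evec, Equiv.Perm.inv_eq_iff_eq, h.2 i h1 h2]

theorem pact_sub (w : Equiv.Perm ℕ) (u v : ℕ → ℤ) : pact w (u - v) = pact w u - pact w v := rfl

/-- `e_{i'} = -e_i` whenever `i' ≠ i`. -/
theorem evec_compl {r₀ i : ℕ} (h1 : 1 ≤ i) (h2 : i ≤ r₀) (hne : r₀ + 1 - i ≠ i) :
    evec r₀ (r₀ + 1 - i) = -evec r₀ i := by
  funext k
  simp only [evec, Pi.neg_apply]
  grind

/-- `e_a - e_b ∈ Σ_P^+` as soon as `a ≤ n < b` and `b ∉ {a', b'}`. -/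
theorem evec_sub_evec_mem_SigmaP {r r₀ n a b : ℕ} {S₀ : Set (ℕ → ℤ)}
    (hr₀ : r₀ = 2 * r ∨ r₀ = 2 * r + 1)
    (ha : 1 ≤ a) (han : a ≤ n) (hnb : n < b) (hb : b ≤ r₀)
    (hab : b ≠ r₀ + 1 - a) (hbb : r₀ + 1 - b ≠ b) :
    evec r₀ a - evec r₀ b ∈ SigmaP r r₀ n S₀ := by
  have hneg := evec_compl (by omega) hb hbb
  have hsub : evec r₀ a - evec r₀ b = evec r₀ a + evec r₀ (r₀ + 1 - b) := by
    rw [hneg, sub_eq_add_neg]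
  by_cases h1 : b ≤ r
  · exact Or.inl (Or.inl ⟨a, b, ha, han, hnb, h1, Or.inl rfl⟩)
  by_cases h2 : n < r₀ + 1 - b
  · exact Or.inl (Or.inl ⟨a, r₀ + 1 - b, ha, han, h2, by omega, Or.inr hsub⟩)
  rcases lt_or_gt_of_ne (show a ≠ r₀ + 1 - b by omega) with h3 | h3
  · exact Or.inl (Or.inr ⟨a, r₀ + 1 - b, ha, h3, by omega, hsub⟩)
  · exact Or.inl (Or.inr ⟨r₀ + 1 - b, a, by omega, h3, han, hsub.trans (add_comm _ _)⟩)

/-- If `w⁻¹ a ≤ n < w⁻¹ b`, then `e_a - e_b` is `w` applied to an element of `Σ_P^+`. -/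
theorem exists_mem_SigmaP_pact_eq {r r₀ n a b : ℕ} {S₀ : Set (ℕ → ℤ)} {w : Equiv.Perm ℕ}
    (hr₀ : r₀ = 2 * r ∨ r₀ = 2 * r + 1) (hw : IsWfull r₀ w)
    (ha : 1 ≤ a) (ha' : a ≤ r₀) (hb : 1 ≤ b) (hb' : b ≤ r₀)
    (hab : b ≠ r₀ + 1 - a) (hbb : r₀ + 1 - b ≠ b)
    (han : w⁻¹ a ≤ n) (hbn : n < w⁻¹ b) :
    ∃ α ∈ SigmaP r r₀ n S₀, pact w α = evec r₀ a - evec r₀ b := by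
  have hA := hw.inv_s12.mem_range ha ha'
  have hB := hw.inv_s12.mem_range hb hb'
  refine ⟨evec r₀ (w⁻¹ a) - evec r₀ (w⁻¹ b),
    evec_sub_evec_mem_SigmaP hr₀ hA.1 han hbn hB.2 ?_ ?_, ?_⟩
  · rw [← hw.inv_s12.2 a ha ha']
    exact fun h => hab ((w⁻¹).injective h)
  · rw [← hw.inv_s12.2 b hb hb']
    exact fun h => hbb ((w⁻¹).injective h)
  · rw [pact_sub, pact_evec hw hA.1 hA.2, pact_evec hw hB.1 hB.2,
      show w (w⁻¹ a) = a from w.apply_symm_apply a, show w (w⁻¹ b) = b from w.apply_symm_apply b]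

/-- if `w ∈ W` is in reduced form and satisfies Hypothesis (L), then
`w⁻¹ k > n` for all `n+1 ≤ k ≤ ℓ−1`. -/
theorem stmt12 (r n ℓ r₀ : ℕ) (so2r : Prop)
    (hn : 1 ≤ n) (hnl : n ≤ ℓ) (hlr : ℓ + 1 ≤ r)
    (hr₀ : r₀ = 2 * r ∨ r₀ = 2 * r + 1) (hso : so2r → r₀ = 2 * r)
    (S₀ : Set (ℕ → ℤ)) (hS₀ : S₀ ⊆ ShortLong r₀ n)
    (w : Equiv.Perm ℕ) (hw : MemW r r₀ so2r w)
    (hred : IsReducedForm r r₀ n so2r w)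
    (hL : HypL r r₀ n ℓ S₀ w) :
    ∀ k, n + 1 ≤ k → k ≤ ℓ - 1 → n < w⁻¹ k := by
  obtain ⟨-, hX, hpos⟩ := hL
  have hW := hw.1
  have hstep : ∀ j, 1 ≤ j → j < ℓ → w⁻¹ j ≤ n → w⁻¹ (j + 1) ≤ n := by
    intro j hj hjl hjn
    by_contra! hc
    obtain ⟨α, hα, hαe⟩ := exists_mem_SigmaP_pact_eq (S₀ := S₀) hr₀ hW hj (by omega)
      (by omega : 1 ≤ j + 1) (by omega) (by omega) (by omega) hjn hc
    have h := hX α hα (Or.inl ⟨j, hj, hjl.le, hαe⟩)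
    have h' := congrFun (hαe.symm.trans h) j
    simp only [rootAlpha, evec, Pi.sub_apply] at h'
    grind
  intro k hk hkl
  by_contra! hkn
  have hall : ∀ j, k ≤ j → j ≤ ℓ → w⁻¹ j ≤ n := by
    intro j hj
    induction j, hj using Nat.le_induction with
    | base => exact fun _ => hkn
    | succ j hj ih => exact fun h => hstep j (by omega) (by omega) (ih (by omega))
  have hl := hall ℓ (by omega) le_rfl
  have hneg : evec r₀ (r₀ + 1 - (ℓ + 1)) = -evec r₀ (ℓ + 1) :=
    evec_compl (by omega) (by omega) (by omega)
  have hL1 := hW.inv_s12.mem_range (i := ℓ) (by omega) (by omega)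
  have hb := hW.inv_s12.mem_range (i := r₀ + 1 - (ℓ + 1)) (by omega) (by omega)
  have hbn : w⁻¹ (r₀ + 1 - (ℓ + 1)) ≤ n := by
    by_contra! hc
    obtain ⟨α, hα, hαe⟩ := exists_mem_SigmaP_pact_eq (S₀ := S₀) (a := ℓ) hr₀ hW (by omega)
      (by omega) (by omega) (by omega) (by omega) (by omega) hl hc
    rw [hneg, sub_neg_eq_add] at hαe
    have h := hX α hα (Or.inr hαe)
    have h' := congrFun (hαe.symm.trans h) (ℓ + 1)
    simp only [rootAlpha, evec, Pi.sub_apply, Pi.add_apply] at h'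
    grind
  refine hpos ⟨w⁻¹ ℓ, w⁻¹ (r₀ + 1 - (ℓ + 1)), hL1.1, hl, hb.1, hbn, ?_⟩
  rw [← pact_evec hW.inv_s12 (by omega) (by omega), ← pact_evec hW.inv_s12 (by omega) (by omega), hneg,
    rootAlpha, sub_eq_add_neg]
  rfl
end
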